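/- Let λ ∈ ℝ with λ ≠ 0 and let s > 0 be real. On the open set of z ∈ ℝ with λ·e^z > −1, the function φ_s = I_1^s is three times differentiable and, writing φ_s', φ_s'', φ_s''' for its successive derivatives, one has: I_2^s = λ^{−1}(φ_s − φ_s'), I_3^s = λ^{−2}(φ_s − (3/2)φ_s' + (1/2)φ_s''), and I_4^s = λ^{−3}(φ_s − (11/6)φ_s' + φ_s'' − (1/6)φ_s'''). -/

import Mathlib

open MeasureTheory Filter Set

/-- The Fermi-type integral `I_k^s(z) = (1/Γ(s)) ∫₀^∞ t^{s-1} / (e^{t-z} + λ)^k dt`. -/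
noncomputable def fermiI (lam s : ℝ) (k : ℕ) (z : ℝ) : ℝ :=
  (1 / Real.Gamma s) * ∫ t in Set.Ioi (0 : ℝ), t ^ (s - 1) / (Real.exp (t - z) + lam) ^ k

/-- Near any point of the domain, the denominator dominates a fixed multiple of `e^t`. -/
lemma mul_exp_le_exp_sub_add {lam c z t : ℝ} (h1 : c ≤ Real.exp (-z))
    (h2 : c ≤ Real.exp (-z) + lam) (ht : 0 ≤ t) :
    c * Real.exp t ≤ Real.exp (t - z) + lam := by
  have e1 : Real.exp (t - z) = Real.exp t * Real.exp (-z) := by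
    rw [← Real.exp_add, sub_eq_add_neg]
  have e2 : 1 ≤ Real.exp t := Real.one_le_exp ht
  rw [e1]
  nlinarith [mul_nonneg (sub_nonneg.2 e2) (sub_nonneg.2 h1)]

lemma fermi_integrand_nonneg_le {lam s c z t : ℝ} (hc : 0 < c) (h1 : c ≤ Real.exp (-z))
    (h2 : c ≤ Real.exp (-z) + lam) (ht : 0 < t) {k : ℕ} (hk : 1 ≤ k) :
    0 ≤ t ^ (s - 1) / (Real.exp (t - z) + lam) ^ k ∧
    t ^ (s - 1) / (Real.exp (t - z) + lam) ^ k
      ≤ (c ^ k)⁻¹ * (Real.exp (-t) * t ^ (s - 1)) := by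
  have hD := mul_exp_le_exp_sub_add h1 h2 ht.le
  have hct : 0 < c * Real.exp t := by positivity
  have hp : 0 < t ^ (s - 1) := Real.rpow_pos_of_pos ht _
  have hD0 : 0 < Real.exp (t - z) + lam := hct.trans_le hD
  refine ⟨by positivity, ?_⟩
  have h3 : c ^ k * Real.exp t ≤ (Real.exp (t - z) + lam) ^ k := by
    calc c ^ k * Real.exp t ≤ c ^ k * Real.exp t ^ k := by
          gcongr
          exact le_self_pow₀ (Real.one_le_exp ht.le) (by omega)
      _ = (c * Real.exp t) ^ k := (mul_pow _ _ _).symm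
      _ ≤ _ := by gcongr
  calc t ^ (s - 1) / (Real.exp (t - z) + lam) ^ k
      ≤ t ^ (s - 1) / (c ^ k * Real.exp t) := by gcongr
    _ = _ := by rw [Real.exp_neg]; field_simp

lemma exp_neg_add_pos {lam z : ℝ} (hz : lam * Real.exp z > -1) : 0 < Real.exp (-z) + lam := by
  have h : Real.exp (-z) + lam = Real.exp (-z) * (1 + lam * Real.exp z) := by
    have : Real.exp (-z) * Real.exp z = 1 := by rw [← Real.exp_add]; simp
    linear_combination -lam * this
  rw [h]
  exact mul_pos (Real.exp_pos _) (by linarith)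

lemma aestronglyMeasurable_fermi_integrand (lam s : ℝ) (k : ℕ) (z : ℝ) :
    AEStronglyMeasurable (fun t : ℝ => t ^ (s - 1) / (Real.exp (t - z) + lam) ^ k)
      (volume.restrict (Ioi 0)) := by
  apply Measurable.aestronglyMeasurable
  fun_prop

lemma integrable_fermi_integrand {lam s : ℝ} (hs : 0 < s) {k : ℕ} (hk : 1 ≤ k) {z : ℝ}
    (hz : lam * Real.exp z > -1) :
    Integrable (fun t : ℝ => t ^ (s - 1) / (Real.exp (t - z) + lam) ^ k)
      (volume.restrict (Ioi 0)) := by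
  have hc : 0 < min (Real.exp (-z)) (Real.exp (-z) + lam) :=
    lt_min (Real.exp_pos _) (exp_neg_add_pos hz)
  refine ((Real.GammaIntegral_convergent hs).const_mul
    ((min (Real.exp (-z)) (Real.exp (-z) + lam)) ^ k)⁻¹).mono'
    (aestronglyMeasurable_fermi_integrand lam s k z) ?_
  filter_upwards [ae_restrict_mem measurableSet_Ioi] with t ht
  have h := fermi_integrand_nonneg_le (s := s) hc (min_le_left _ _) (min_le_right _ _) ht hk
  rw [Real.norm_of_nonneg h.1]
  exact h.2

/-- The differential recurrence `(I_k^s)' = k (I_k^s - λ I_{k+1}^s)`. -/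
lemma hasDerivAt_fermiI {lam s : ℝ} (hs : 0 < s) {k : ℕ} (hk : 1 ≤ k) {z : ℝ}
    (hz : lam * Real.exp z > -1) :
    HasDerivAt (fermiI lam s k) (k * (fermiI lam s k z - lam * fermiI lam s (k + 1) z)) z := by
  obtain ⟨c, hc, hcz⟩ := exists_between (lt_min (Real.exp_pos (-z)) (exp_neg_add_pos hz))
  rw [lt_min_iff] at hcz
  have hU : {w : ℝ | c < Real.exp (-w) ∧ c < Real.exp (-w) + lam} ∈ nhds z := by
    have h1 : Continuous fun w : ℝ => Real.exp (-w) := by fun_prop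
    exact ((isOpen_lt continuous_const h1).inter
      (isOpen_lt continuous_const (h1.add_const lam))).mem_nhds hcz
  have hint := integrable_fermi_integrand hs hk hz
  have hint' := integrable_fermi_integrand hs (Nat.le_add_left 1 k) hz
  have key := hasDerivAt_integral_of_dominated_loc_of_deriv_le
    (μ := volume.restrict (Ioi (0 : ℝ)))
    (F := fun w t : ℝ => t ^ (s - 1) / (Real.exp (t - w) + lam) ^ k)
    (F' := fun w t : ℝ => k * (t ^ (s - 1) / (Real.exp (t - w) + lam) ^ k
      - lam * (t ^ (s - 1) / (Real.exp (t - w) + lam) ^ (k + 1))))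
    (bound := fun t => k * ((c ^ k)⁻¹ * (Real.exp (-t) * t ^ (s - 1))
      + |lam| * ((c ^ (k + 1))⁻¹ * (Real.exp (-t) * t ^ (s - 1)))))
    hU (Eventually.of_forall fun w => aestronglyMeasurable_fermi_integrand lam s k w)
    hint ((hint.sub (hint'.const_mul lam)).const_mul (k : ℝ)).aestronglyMeasurable
    ?_ ?_ ?_
  · have h := key.2.const_mul (1 / Real.Gamma s)
    rw [integral_const_mul, integral_sub hint (hint'.const_mul lam), integral_const_mul] at h
    refine h.congr_deriv ?_
    simp only [fermiI]
    ring
  · filter_upwards [ae_restrict_mem measurableSet_Ioi] with t ht w hw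
    have h := fermi_integrand_nonneg_le (s := s) hc hw.1.le hw.2.le ht hk
    have h' := fermi_integrand_nonneg_le (s := s) hc hw.1.le hw.2.le ht (Nat.le_add_left 1 k)
    rw [norm_mul, Real.norm_natCast]
    gcongr
    refine (norm_sub_le _ _).trans ?_
    rw [norm_mul, Real.norm_of_nonneg h.1, Real.norm_of_nonneg h'.1, Real.norm_eq_abs]
    gcongr
    · exact h.2
    · exact h'.2
  · have hG := Real.GammaIntegral_convergent hs
    exact ((hG.const_mul _).add ((hG.const_mul _).const_mul _)).const_mul _
  · filter_upwards [ae_restrict_mem measurableSet_Ioi] with t ht w hw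
    have hD : 0 < Real.exp (t - w) + lam :=
      (mul_pos hc (Real.exp_pos t)).trans_le
        (mul_exp_le_exp_sub_add hw.1.le hw.2.le (mem_Ioi.1 ht).le)
    have h1 : HasDerivAt (fun w : ℝ => Real.exp (t - w) + lam) (-Real.exp (t - w)) w := by
      simpa using (((hasDerivAt_id w).const_sub t).exp.add_const lam)
    refine ((hasDerivAt_const w (t ^ (s - 1))).fun_div (h1.fun_pow k)
      (pow_ne_zero k hD.ne')).congr_deriv ?_
    obtain ⟨n, rfl⟩ : ∃ n, k = n + 1 := ⟨k - 1, by omega⟩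
    simp only [Nat.add_sub_cancel]
    field_simp
    ring

lemma isOpen_fermi_domain (lam : ℝ) : IsOpen {z : ℝ | lam * Real.exp z > -1} :=
  isOpen_lt continuous_const (by fun_prop)

/-- For `λ ≠ 0` and `s > 0`, on the open set `{z | λ·e^z > -1}` the function
`φ_s = I_1^s` is three times differentiable and
`I_2^s = λ⁻¹(φ_s - φ_s')`,
`I_3^s = λ⁻²(φ_s - (3/2)φ_s' + (1/2)φ_s'')`,
`I_4^s = λ⁻³(φ_s - (11/6)φ_s' + φ_s'' - (1/6)φ_s''')`. -/
theorem fermiI_low_orders (lam s : ℝ) (hlam : lam ≠ 0) (hs : 0 < s) :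
    (∀ z : ℝ, lam * Real.exp z > -1 → DifferentiableAt ℝ (fermiI lam s 1) z) ∧
    (∀ z : ℝ, lam * Real.exp z > -1 → DifferentiableAt ℝ (deriv (fermiI lam s 1)) z) ∧
    (∀ z : ℝ, lam * Real.exp z > -1 →
      DifferentiableAt ℝ (deriv (deriv (fermiI lam s 1))) z) ∧
    (∀ z : ℝ, lam * Real.exp z > -1 →
      fermiI lam s 2 z = lam⁻¹ * (fermiI lam s 1 z - deriv (fermiI lam s 1) z) ∧
      fermiI lam s 3 z = lam⁻¹ ^ 2 * (fermiI lam s 1 z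
        - (3 / 2) * deriv (fermiI lam s 1) z
        + (1 / 2) * deriv (deriv (fermiI lam s 1)) z) ∧
      fermiI lam s 4 z = lam⁻¹ ^ 3 * (fermiI lam s 1 z
        - (11 / 6) * deriv (fermiI lam s 1) z
        + deriv (deriv (fermiI lam s 1)) z
        - (1 / 6) * deriv (deriv (deriv (fermiI lam s 1))) z)) := by
  have d1 : ∀ z : ℝ, lam * Real.exp z > -1 → HasDerivAt (fermiI lam s 1)
      (fermiI lam s 1 z - lam * fermiI lam s 2 z) z := fun z hz => by
    simpa using hasDerivAt_fermiI hs le_rfl hz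
  have d2 : ∀ z : ℝ, lam * Real.exp z > -1 → HasDerivAt (fermiI lam s 2)
      (2 * (fermiI lam s 2 z - lam * fermiI lam s 3 z)) z := fun z hz => by
    simpa using hasDerivAt_fermiI hs one_le_two hz
  have d3 : ∀ z : ℝ, lam * Real.exp z > -1 → HasDerivAt (fermiI lam s 3)
      (3 * (fermiI lam s 3 z - lam * fermiI lam s 4 z)) z := fun z hz => by
    simpa using hasDerivAt_fermiI (k := 3) hs (by norm_num) hz
  have e1 : ∀ z : ℝ, lam * Real.exp z > -1 → HasDerivAt (deriv (fermiI lam s 1))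
      (fermiI lam s 1 z - 3 * lam * fermiI lam s 2 z + 2 * lam ^ 2 * fermiI lam s 3 z) z := by
    intro z hz
    have h := (d1 z hz).fun_sub ((d2 z hz).const_mul lam)
    refine (h.congr_of_eventuallyEq ?_).congr_deriv (by ring)
    filter_upwards [(isOpen_fermi_domain lam).mem_nhds hz] with w hw using (d1 w hw).deriv
  have e2 : ∀ z : ℝ, lam * Real.exp z > -1 → HasDerivAt (deriv (deriv (fermiI lam s 1)))
      (fermiI lam s 1 z - 7 * lam * fermiI lam s 2 z + 12 * lam ^ 2 * fermiI lam s 3 z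
        - 6 * lam ^ 3 * fermiI lam s 4 z) z := by
    intro z hz
    have h := ((d1 z hz).fun_sub ((d2 z hz).const_mul (3 * lam))).fun_add
      ((d3 z hz).const_mul (2 * lam ^ 2))
    refine (h.congr_of_eventuallyEq ?_).congr_deriv (by ring)
    filter_upwards [(isOpen_fermi_domain lam).mem_nhds hz] with w hw using (e1 w hw).deriv
  refine ⟨fun z hz => (d1 z hz).differentiableAt, fun z hz => (e1 z hz).differentiableAt,
    fun z hz => (e2 z hz).differentiableAt, fun z hz => ?_⟩
  rw [(d1 z hz).deriv, (e1 z hz).deriv, (e2 z hz).deriv]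
  refine ⟨?_, ?_, ?_⟩ <;> field_simp <;> ring
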